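/- Assume u_1,…,u_r are invertible in R. For all w, u ∈ S_n and all (c_1,…,c_n), (d_1,…,d_n) ∈ [0,r−1]^n, one has τ( t_1^{c_1}⋯t_n^{c_n}·g_w · (t_1^{d_1}⋯t_n^{d_n}·g_u)^∨ ) = 1 if w = u and c_i = d_i for all i, and 0 otherwise. In other words, the family {(t_1^{c_1}⋯t_n^{c_n} g_w)^∨} is dual to the basis {t_1^{c_1}⋯t_n^{c_n} g_w} with respect to the pairing (x,y) ↦ τ(xy). -/

import Mathlib

open Polynomial

namespace MAK

noncomputable section

variable (R : Type*) [CommRing R] (n r : ℕ) (q Δ : Rˣ) (u : Fin r → R) (F : Fin r → R[X])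

/-- The free `R`-algebra on generators `t_1, …, t_n` (left) and `T_1, …, T_{n-1}` (right). -/
abbrev FA := FreeAlgebra R (Fin n ⊕ Fin (n - 1))

/-- The generators `t_i`. -/
def tf (i : Fin n) : FA R n := FreeAlgebra.ι R (Sum.inl i)

/-- The generators `T_j`. -/
def Tf (j : Fin (n - 1)) : FA R n := FreeAlgebra.ι R (Sum.inr j)

/-- The index `j`, viewed in `Fin n`. -/
def lo (j : Fin (n - 1)) : Fin n := ⟨j.1, by have := j.2; omega⟩

/-- The index `j + 1`, viewed in `Fin n`. -/
def hi (j : Fin (n - 1)) : Fin n := ⟨j.1 + 1, by have := j.2; omega⟩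

/-- The element `B_j = Δ⁻² Σ_{c1<c2} (u_{c2} - u_{c1})(q - q⁻¹) F_{c1}(t_j) F_{c2}(t_{j+1})`. -/
def Bel (j : Fin (n - 1)) : FA R n :=
  ∑ c2 : Fin r, ∑ c1 ∈ Finset.univ.filter (fun c1 => c1 < c2),
    (((Δ⁻¹ : Rˣ) : R) ^ 2 * ((u c2 - u c1) * ((q : R) - ((q⁻¹ : Rˣ) : R)))) •
      (aeval (tf R n (lo n j)) (F c1) * aeval (tf R n (hi n j)) (F c2))

/-- The defining relations of the modified Ariki-Koike algebra. -/
inductive Rel : FA R n → FA R n → Prop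
  | quad (j : Fin (n - 1)) :
      Rel ((Tf R n j - algebraMap R (FA R n) (q : R)) *
        (Tf R n j + algebraMap R (FA R n) ((q⁻¹ : Rˣ) : R))) 0
  | tord (i : Fin n) : Rel (aeval (tf R n i) (∏ c : Fin r, (X - C (u c)))) 0
  | braid (j k : Fin (n - 1)) (h : k.1 = j.1 + 1) :
      Rel (Tf R n j * Tf R n k * Tf R n j) (Tf R n k * Tf R n j * Tf R n k)
  | Tcomm (j k : Fin (n - 1)) (h : j.1 + 2 ≤ k.1 ∨ k.1 + 2 ≤ j.1) :
      Rel (Tf R n j * Tf R n k) (Tf R n k * Tf R n j)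
  | tcomm (i i' : Fin n) : Rel (tf R n i * tf R n i') (tf R n i' * tf R n i)
  | Tt (j : Fin (n - 1)) (i : Fin n) (h1 : i ≠ lo n j) (h2 : i ≠ hi n j) :
      Rel (Tf R n j * tf R n i) (tf R n i * Tf R n j)
  | Thi (j : Fin (n - 1)) :
      Rel (Tf R n j * tf R n (hi n j)) (tf R n (lo n j) * Tf R n j + Bel R n r q Δ u F j)
  | Tlo (j : Fin (n - 1)) :
      Rel (Tf R n j * tf R n (lo n j)) (tf R n (hi n j) * Tf R n j - Bel R n r q Δ u F j)

/-- The modified Ariki-Koike algebra `H_{n,r}(R, q, u_1, …, u_r)`. -/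
abbrev Hnr := RingQuot (Rel R n r q Δ u F)

/-- The canonical projection. -/
def pim : FA R n →ₐ[R] Hnr R n r q Δ u F := RingQuot.mkAlgHom R (Rel R n r q Δ u F)

/-- The generator `t_i` of `H_{n,r}`. -/
def tt (i : Fin n) : Hnr R n r q Δ u F := pim R n r q Δ u F (tf R n i)

/-- The generator `T_j` of `H_{n,r}`. -/
def TT (j : Fin (n - 1)) : Hnr R n r q Δ u F := pim R n r q Δ u F (Tf R n j)

/-- The Lagrange basis polynomial `∏_{j ≠ c} (X - u_j)/(u_c - u_j)`. -/
def bpoly (c : Fin r) : R[X] :=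
  ∏ j ∈ Finset.univ.filter (fun j => j ≠ c), Ring.inverse (u c - u j) • (X - C (u j))

/-- The idempotent `b_{k_1, …, k_n}`. -/
def b (k : Fin n → Fin r) : Hnr R n r q Δ u F :=
  (List.ofFn fun i : Fin n => aeval (tt R n r q Δ u F i) (bpoly R r u (k i))).prod

/-- The element `B'_{i,j} = -(q - q⁻¹) Σ_{k_i < k_j} b_{k_1, …, k_n}`. -/
def B' (i j : Fin n) : Hnr R n r q Δ u F :=
  -(((q : R) - ((q⁻¹ : Rˣ) : R)) •
    ∑ k ∈ Finset.univ.filter (fun k : Fin n → Fin r => k i < k j), b R n r q Δ u F k)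

/-- The element `g_i := T_i + B'_{i,i+1}`. -/
def g (j : Fin (n - 1)) : Hnr R n r q Δ u F :=
  TT R n r q Δ u F j + B' R n r q Δ u F (lo n j) (hi n j)

/-- The idempotent `e_{i,j} = Σ_{k_i = k_j} b_{k_1, …, k_n}`. -/
def eij (i j : Fin n) : Hnr R n r q Δ u F :=
  ∑ k ∈ Finset.univ.filter (fun k : Fin n → Fin r => k i = k j), b R n r q Δ u F k

/-- The idempotent `e_i = e_{i,i+1}`. -/
def ee (j : Fin (n - 1)) : Hnr R n r q Δ u F := eij R n r q Δ u F (lo n j) (hi n j)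

/-- The simple transposition `s_j = (j, j+1)` in `S_n`. -/
def simple (j : Fin (n - 1)) : Equiv.Perm (Fin n) := Equiv.swap (lo n j) (hi n j)

/-- `l` is a reduced word for the permutation `w`. -/
def IsReducedWord (w : Equiv.Perm (Fin n)) (l : List (Fin (n - 1))) : Prop :=
  (l.map (simple n)).prod = w ∧
    ∀ l' : List (Fin (n - 1)), (l'.map (simple n)).prod = w → l.length ≤ l'.length

/-- The element `g_w = g_{i_1} ⋯ g_{i_l}` associated to a word `l = (i_1, …, i_l)`. -/
def gword (l : List (Fin (n - 1))) : Hnr R n r q Δ u F := (l.map (g R n r q Δ u F)).prod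

/-- The element `T_w = T_{i_1} ⋯ T_{i_l}` associated to a word `l = (i_1, …, i_l)`. -/
def Tword (l : List (Fin (n - 1))) : Hnr R n r q Δ u F := (l.map (TT R n r q Δ u F)).prod

/-- The monomial `t_1^{c_1} ⋯ t_n^{c_n}`. -/
def tmon (c : Fin n → ℕ) : Hnr R n r q Δ u F :=
  (List.ofFn fun i : Fin n => tt R n r q Δ u F i ^ c i).prod

end

end MAK

open MAK


namespace MAK

noncomputable section

variable (R : Type*) [CommRing R] (n r : ℕ) (q Δ : Rˣ) (u : Fin r → R) (F : Fin r → R[X])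

/-- `σ_j(u_1,…,u_r)`, the `j`-th elementary symmetric polynomial in `u_1,…,u_r`. -/
def esym (j : ℕ) : R :=
  ∑ S ∈ Finset.powersetCard j (Finset.univ : Finset (Fin r)), ∏ i ∈ S, u i

/-- The dual element `(t_i^c)^∨ = ((-1)^{r+1}/σ_r) ∑_{j=0}^{r-c-1} (-1)^j σ_j t_i^{r-c-j}`. -/
def tdual (i : Fin n) (c : ℕ) : Hnr R n r q Δ u F :=
  ((-1 : R) ^ (r + 1) * Ring.inverse (∏ i : Fin r, u i)) •
    ∑ j ∈ Finset.range (r - c),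
      ((-1 : R) ^ j * esym R r u j) • tt R n r q Δ u F i ^ (r - c - j)

/-- The product `∏_{i : c_i ≠ 0} (t_i^{c_i})^∨`. -/
def tdualprod (c : Fin n → ℕ) : Hnr R n r q Δ u F :=
  (List.ofFn fun i : Fin n =>
    if c i = 0 then 1 else tdual R n r q Δ u F i (c i)).prod

end

end MAK

namespace MAK

section Permutations

variable {n : ℕ}

/-- The inversions of a permutation of `Fin n`. -/
def inversions (w : Equiv.Perm (Fin n)) : Finset (Fin n × Fin n) :=
  Finset.univ.filter fun p => p.1 < p.2 ∧ w p.2 < w p.1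

lemma mem_inversions {w : Equiv.Perm (Fin n)} {a b : Fin n} :
    (a, b) ∈ inversions w ↔ a < b ∧ w b < w a := by
  rw [inversions, Finset.mem_filter]
  simp only [Finset.mem_univ, true_and]

lemma simple_mul_self (j : Fin (n - 1)) : simple n j * simple n j = 1 :=
  Equiv.swap_mul_self _ _

lemma simple_simple_apply (j : Fin (n - 1)) (x : Fin n) : simple n j (simple n j x) = x :=
  Equiv.swap_apply_self _ _ _

lemma simple_lo (j : Fin (n - 1)) : simple n j (lo n j) = hi n j := Equiv.swap_apply_left _ _

lemma simple_hi (j : Fin (n - 1)) : simple n j (hi n j) = lo n j := Equiv.swap_apply_right _ _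

lemma simple_of_ne (j : Fin (n - 1)) {x : Fin n} (h1 : x ≠ lo n j) (h2 : x ≠ hi n j) :
    simple n j x = x := Equiv.swap_apply_of_ne_of_ne h1 h2

lemma lo_lt_hi (j : Fin (n - 1)) : lo n j < hi n j := by simp [lo, hi]

lemma lo_ne_hi (j : Fin (n - 1)) : lo n j ≠ hi n j := (lo_lt_hi j).ne

lemma simple_lt_simple (j : Fin (n - 1)) {a b : Fin n} (hab : a < b)
    (h : ¬ (a = lo n j ∧ b = hi n j)) : simple n j a < simple n j b := by
  unfold simple
  rw [Equiv.swap_apply_def, Equiv.swap_apply_def]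
  simp only [lo, hi, Fin.ext_iff] at *
  split_ifs <;> simp only [Fin.lt_def] at * <;> omega

lemma card_inversions_mul_simple {w : Equiv.Perm (Fin n)} {j : Fin (n - 1)}
    (h : w (lo n j) < w (hi n j)) :
    (inversions (w * simple n j)).card = (inversions w).card + 1 := by
  have hs : inversions (w * simple n j) = insert (lo n j, hi n j)
      ((inversions w).map ((simple n j).prodCongr (simple n j)).toEmbedding) := by
    ext ⟨a, b⟩
    have hsymm : (simple n j).symm = simple n j := Equiv.symm_swap _ _
    simp only [Finset.mem_insert, Finset.mem_map_equiv, Equiv.prodCongr_symm,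
      Equiv.prodCongr_apply, Prod.map_apply, hsymm, mem_inversions, Equiv.Perm.mul_apply,
      Prod.mk.injEq]
    constructor
    · rintro ⟨h1, h2⟩
      by_cases hab : a = lo n j ∧ b = hi n j
      · exact Or.inl hab
      · exact Or.inr ⟨simple_lt_simple j h1 hab, h2⟩
    · rintro (⟨rfl, rfl⟩ | ⟨h1, h2⟩)
      · rw [simple_lo, simple_hi]
        exact ⟨lo_lt_hi j, h⟩
      · refine ⟨?_, h2⟩
        have := simple_lt_simple j h1 (by
          rintro ⟨h3, h4⟩
          rw [h3, h4] at h2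
          exact absurd h2 h.not_gt)
        rwa [simple_simple_apply, simple_simple_apply] at this
  rw [hs, Finset.card_insert_of_notMem, Finset.card_map]
  rw [Finset.mem_map_equiv]
  have hsymm : (simple n j).symm = simple n j := Equiv.symm_swap _ _
  simp only [Equiv.prodCongr_symm, Equiv.prodCongr_apply, Prod.map_apply, hsymm, mem_inversions,
    simple_lo, simple_hi]
  exact fun h' => absurd h'.1 (lo_lt_hi j).not_gt

lemma card_inversions_mul_simple_of_gt {w : Equiv.Perm (Fin n)} {j : Fin (n - 1)}
    (h : w (hi n j) < w (lo n j)) :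
    (inversions w).card = (inversions (w * simple n j)).card + 1 := by
  have := card_inversions_mul_simple (w := w * simple n j) (j := j)
    (by simpa [simple_lo, simple_hi] using h)
  rwa [mul_assoc, simple_mul_self, mul_one] at this

lemma apply_lo_lt_or_gt (w : Equiv.Perm (Fin n)) (j : Fin (n - 1)) :
    w (lo n j) < w (hi n j) ∨ w (hi n j) < w (lo n j) :=
  lt_or_gt_of_ne (w.injective.ne (lo_ne_hi j))

lemma inversions_one : inversions (1 : Equiv.Perm (Fin n)) = ∅ := by
  ext ⟨a, b⟩
  simpa [mem_inversions] using fun h : a < b => h.le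

lemma card_inversions_prod_le (l : List (Fin (n - 1))) :
    (inversions (l.map (simple n)).prod).card ≤ l.length := by
  induction l using List.reverseRecOn with
  | nil => simp [inversions_one]
  | append_singleton l j ih =>
    simp only [List.map_append, List.map_cons, List.map_nil, List.prod_append, List.prod_singleton,
      List.length_append, List.length_singleton]
    rcases apply_lo_lt_or_gt (l.map (simple n)).prod j with h | h
    · rw [card_inversions_mul_simple h]; omega
    · have := card_inversions_mul_simple_of_gt h; omega

lemma eq_one_of_forall_lo_lt_hi {w : Equiv.Perm (Fin n)}
    (h : ∀ j : Fin (n - 1), w (lo n j) < w (hi n j)) : w = 1 := by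
  cases n with
  | zero => exact Subsingleton.elim _ _
  | succ m =>
    have hmono : StrictMono w := Fin.strictMono_iff_lt_succ.2 fun i => h i
    have : hmono.orderIsoOfSurjective w w.surjective = OrderIso.refl _ := Subsingleton.elim _ _
    ext x
    exact congrArg Fin.val (DFunLike.congr_fun this x)

lemma exists_word (w : Equiv.Perm (Fin n)) :
    ∃ l : List (Fin (n - 1)), (l.map (simple n)).prod = w ∧ l.length = (inversions w).card := by
  induction hN : (inversions w).card generalizing w with
  | zero =>
    refine ⟨[], ?_, rfl⟩
    refine (eq_one_of_forall_lo_lt_hi fun j => ?_).symm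
    refine (apply_lo_lt_or_gt w j).resolve_right fun h => ?_
    have := card_inversions_mul_simple_of_gt h
    omega
  | succ N ih =>
    have : ∃ j : Fin (n - 1), w (hi n j) < w (lo n j) := by
      by_contra! hcon
      have := eq_one_of_forall_lo_lt_hi (w := w) fun j =>
        (apply_lo_lt_or_gt w j).resolve_right (hcon j).not_gt
      rw [this, inversions_one] at hN
      simp at hN
    obtain ⟨j, hj⟩ := this
    have hc := card_inversions_mul_simple_of_gt hj
    obtain ⟨l, hl, hlen⟩ := ih (w * simple n j) (by omega)
    refine ⟨l ++ [j], ?_, by simp [hlen]⟩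
    simp [hl, mul_assoc, simple_mul_self]

lemma isReducedWord_iff {w : Equiv.Perm (Fin n)} {l : List (Fin (n - 1))} :
    IsReducedWord n w l ↔ (l.map (simple n)).prod = w ∧ l.length = (inversions w).card := by
  constructor
  · rintro ⟨h1, h2⟩
    obtain ⟨l', hl', hlen⟩ := exists_word w
    have h3 := h2 l' hl'
    have h4 := card_inversions_prod_le l
    rw [h1] at h4
    exact ⟨h1, by omega⟩
  · rintro ⟨h1, h2⟩
    refine ⟨h1, fun l' hl' => ?_⟩
    have := card_inversions_prod_le l'
    rw [hl'] at this
    omega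

lemma exists_isReducedWord (w : Equiv.Perm (Fin n)) : ∃ l, IsReducedWord n w l := by
  obtain ⟨l, hl⟩ := exists_word w
  exact ⟨l, isReducedWord_iff.2 hl⟩

lemma isReducedWord_nil : IsReducedWord n 1 [] := ⟨rfl, fun _ _ => Nat.zero_le _⟩

lemma IsReducedWord.eq_nil {l : List (Fin (n - 1))} (h : IsReducedWord n 1 l) : l = [] := by
  have := (isReducedWord_iff.1 h).2
  rw [inversions_one] at this
  simpa using this

lemma IsReducedWord.reverse {w : Equiv.Perm (Fin n)} {l : List (Fin (n - 1))}
    (h : IsReducedWord n w l) : IsReducedWord n w⁻¹ l.reverse := by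
  have key : ∀ l : List (Fin (n - 1)),
      (l.reverse.map (simple n)).prod = ((l.map (simple n)).prod)⁻¹ := by
    intro l
    rw [List.prod_inv_reverse, List.map_map, List.map_reverse]
    congr 2
  refine ⟨by rw [key, h.1], fun l' hl' => ?_⟩
  have := h.2 l'.reverse (by rw [key, hl', inv_inv])
  simpa using this

lemma IsReducedWord.append_singleton {w : Equiv.Perm (Fin n)} {l : List (Fin (n - 1))}
    {j : Fin (n - 1)} (h : IsReducedWord n w l) (hj : w (lo n j) < w (hi n j)) :
    IsReducedWord n (w * simple n j) (l ++ [j]) := by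
  rw [isReducedWord_iff] at h ⊢
  rw [card_inversions_mul_simple hj]
  simp [h.1, h.2]

lemma IsReducedWord.of_append_singleton {w : Equiv.Perm (Fin n)} {l : List (Fin (n - 1))}
    {j : Fin (n - 1)} (h : IsReducedWord n w (l ++ [j])) :
    IsReducedWord n (w * simple n j) l ∧ w (hi n j) < w (lo n j) := by
  rw [isReducedWord_iff] at h
  have h1 : (l.map (simple n)).prod = w * simple n j := by
    rw [← h.1]
    simp [mul_assoc, simple_mul_self]
  have h2 := h.2
  rw [List.length_append, List.length_singleton] at h2
  have h3 := card_inversions_prod_le l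
  rw [h1] at h3
  have h4 : w (hi n j) < w (lo n j) := by
    refine (apply_lo_lt_or_gt w j).resolve_left fun h => ?_
    have := card_inversions_mul_simple h
    omega
  refine ⟨isReducedWord_iff.2 ⟨h1, ?_⟩, h4⟩
  have := card_inversions_mul_simple_of_gt h4
  omega

lemma IsReducedWord.tail {w : Equiv.Perm (Fin n)} {l : List (Fin (n - 1))}
    {j : Fin (n - 1)} (h : IsReducedWord n w (j :: l)) :
    IsReducedWord n (simple n j * w) l := by
  refine ⟨?_, fun l' hl' => ?_⟩
  · rw [← h.1]
    simp [← mul_assoc, simple_mul_self]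
  · have := h.2 (j :: l') (by simp [hl', ← mul_assoc, simple_mul_self])
    simpa using this

lemma IsReducedWord.exists_append_singleton {w : Equiv.Perm (Fin n)} {j : Fin (n - 1)}
    (hj : w (hi n j) < w (lo n j)) :
    ∃ l, IsReducedWord n (w * simple n j) l ∧ IsReducedWord n w (l ++ [j]) := by
  obtain ⟨l, hl⟩ := exists_isReducedWord (w * simple n j)
  refine ⟨l, hl, ?_⟩
  have := hl.append_singleton (j := j) (by simpa [simple_lo, simple_hi] using hj)
  rwa [mul_assoc, simple_mul_self, mul_one] at this

/-- Matsumoto's theorem for the symmetric group: a family satisfying the braid relations takes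
the same product along any two reduced words of a permutation. -/
theorem IsReducedWord.prod_map_eq {M : Type*} [Monoid M] (f : Fin (n - 1) → M)
    (hcomm : ∀ j k : Fin (n - 1), j.1 + 2 ≤ k.1 → f j * f k = f k * f j)
    (hbraid : ∀ j k : Fin (n - 1), k.1 = j.1 + 1 → f j * f k * f j = f k * f j * f k)
    {w : Equiv.Perm (Fin n)} {l l' : List (Fin (n - 1))}
    (hl : IsReducedWord n w l) (hl' : IsReducedWord n w l') :
    (l.map f).prod = (l'.map f).prod := by
  induction hN : (inversions w).card using Nat.strong_induction_on generalizing w l l' with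
  | _ N ih =>
  subst hN
  have hP : ∀ (l : List (Fin (n - 1))) (j : Fin (n - 1)),
      ((l ++ [j]).map f).prod = (l.map f).prod * f j := fun l j => by simp
  have step : ∀ (w₁ : Equiv.Perm (Fin n)) (l₁ l₂ : List (Fin (n - 1))) (j : Fin (n - 1)),
      (inversions w₁).card ≤ (inversions w).card → w₁ (hi n j) < w₁ (lo n j) →
      IsReducedWord n (w₁ * simple n j) l₁ → IsReducedWord n (w₁ * simple n j) l₂ →
      (l₁.map f).prod = (l₂.map f).prod := fun w₁ l₁ l₂ j hle hj h₁ h₂ => by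
    have := card_inversions_mul_simple_of_gt hj
    exact ih _ (by omega) h₁ h₂ rfl
  have main : ∀ (j k : Fin (n - 1)) (l l' : List (Fin (n - 1))), j.1 < k.1 →
      IsReducedWord n w (l ++ [j]) → IsReducedWord n w (l' ++ [k]) →
      ((l ++ [j]).map f).prod = ((l' ++ [k]).map f).prod := by
    intro j k l l' hjk hl hl'
    obtain ⟨h1, h2⟩ := hl.of_append_singleton
    obtain ⟨h3, h4⟩ := hl'.of_append_singleton
    have c1 := card_inversions_mul_simple_of_gt h2
    have c2 := card_inversions_mul_simple_of_gt h4
    by_cases hadj : k.1 = j.1 + 1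
    · have e1 : lo n k = hi n j := by simp [lo, hi, hadj]
      have f1 : simple n j (hi n k) = hi n k :=
        simple_of_ne _ (by simp [lo, hi, Fin.ext_iff]; omega) (by simp [hi, Fin.ext_iff]; omega)
      have f2 : simple n k (lo n j) = lo n j :=
        simple_of_ne _ (by simp [lo, Fin.ext_iff]; omega) (by simp [lo, hi, Fin.ext_iff]; omega)
      have f3 : simple n k (hi n j) = hi n k := by rw [← e1, simple_lo]
      have f4 : simple n j (lo n k) = lo n j := by rw [e1, simple_hi]
      have hs : simple n j * simple n k * simple n j = simple n k * simple n j * simple n k := by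
        have hne : lo n j ≠ hi n k := ((lo_lt_hi j).trans (e1 ▸ lo_lt_hi k)).ne
        rw [simple, simple, e1, Equiv.swap_mul_swap_mul_swap (lo_ne_hi j) hne,
          Equiv.swap_comm (lo n j), Equiv.swap_comm (hi n j) (hi n k),
          Equiv.swap_mul_swap_mul_swap (e1 ▸ lo_ne_hi k).symm hne.symm,
          Equiv.swap_comm]
      rw [e1] at h4
      have d1 : (w * simple n j) (hi n k) < (w * simple n j) (lo n k) := by
        simp only [Equiv.Perm.mul_apply, f1, f4]
        exact h4.trans h2
      have d2 : (w * simple n k) (hi n j) < (w * simple n k) (lo n j) := by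
        simp only [Equiv.Perm.mul_apply, f2, f3]
        exact h4.trans h2
      have d3 : (w * simple n j * simple n k) (hi n j) <
          (w * simple n j * simple n k) (lo n j) := by
        simp only [Equiv.Perm.mul_apply, f2, f3, f1, simple_lo]
        exact h4
      obtain ⟨m, hm1, hm2⟩ := IsReducedWord.exists_append_singleton d3
      have hm3 := hm2.append_singleton (j := k) (by simpa [simple_lo, simple_hi] using d1)
      have hm4 : IsReducedWord n (w * simple n k * simple n j) (m ++ [k]) := by
        have := hm1.append_singleton (j := k) (by
          simp only [Equiv.Perm.mul_apply, simple_lo, simple_hi, f1, f2, f4]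
          exact h2)
        have e2 : w * simple n j * simple n k * simple n j * simple n k =
            w * simple n k * simple n j := by
          rw [mul_assoc w, mul_assoc w, hs]
          simp [mul_assoc, simple_mul_self]
        rwa [e2] at this
      have hm5 := hm4.append_singleton (j := j) (by simpa [simple_lo, simple_hi] using d2)
      have e3 : ∀ v : Equiv.Perm (Fin n), ∀ i, v * simple n i * simple n i = v := fun v i => by
        rw [mul_assoc, simple_mul_self, mul_one]
      rw [e3] at hm3 hm5
      have r1 := step w _ _ j le_rfl h2 h1 hm3
      have r2 := step w _ _ k le_rfl (by rw [e1]; exact h4) h3 hm5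
      rw [hP, hP, r1, r2, hP, hP, hP, hP]
      simpa [mul_assoc] using congrArg ((m.map f).prod * ·) (hbraid j k hadj)
    · have f1 : simple n j (hi n k) = hi n k :=
        simple_of_ne _ (by simp [lo, hi, Fin.ext_iff]; omega) (by simp [hi, Fin.ext_iff]; omega)
      have f2 : simple n j (lo n k) = lo n k :=
        simple_of_ne _ (by simp [lo, Fin.ext_iff]; omega) (by simp [lo, hi, Fin.ext_iff]; omega)
      have f3 : simple n k (hi n j) = hi n j :=
        simple_of_ne _ (by simp [lo, hi, Fin.ext_iff]; omega) (by simp [hi, Fin.ext_iff]; omega)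
      have f4 : simple n k (lo n j) = lo n j :=
        simple_of_ne _ (by simp [lo, Fin.ext_iff]; omega) (by simp [lo, hi, Fin.ext_iff]; omega)
      have hs : simple n j * simple n k = simple n k * simple n j := by
        have hd : Equiv.Perm.Disjoint (simple n j) (simple n k) := fun x => by
          by_cases hx : x = lo n j ∨ x = hi n j
          · rcases hx with rfl | rfl
            · exact Or.inr f4
            · exact Or.inr f3
          · push Not at hx
            exact Or.inl (simple_of_ne j hx.1 hx.2)
        exact hd.commute
      have d1 : (w * simple n j) (hi n k) < (w * simple n j) (lo n k) := by
        simpa [f1, f2] using h4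
      obtain ⟨m, hm1, hm2⟩ := IsReducedWord.exists_append_singleton d1
      have hm3 : IsReducedWord n (w * simple n k) (m ++ [j]) := by
        have := hm1.append_singleton (j := j) (by simpa [f3, f4, simple_lo, simple_hi] using h2)
        rwa [mul_assoc w, hs, ← mul_assoc, mul_assoc, simple_mul_self, mul_one] at this
      have r1 := step w _ _ j le_rfl h2 h1 hm2
      have r2 := step w _ _ k le_rfl h4 h3 hm3
      rw [hP, hP, r1, r2, hP, hP, mul_assoc, mul_assoc, hcomm j k (by omega)]
  rcases List.eq_nil_or_concat l with rfl | ⟨l, j, rfl⟩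
  · have : w = 1 := hl.1.symm
    subst this
    rw [hl'.eq_nil]
  rcases List.eq_nil_or_concat l' with rfl | ⟨l', k, rfl⟩
  · have : w = 1 := hl'.1.symm
    subst this
    rw [hl.eq_nil]
  rw [List.concat_eq_append] at *
  rw [List.concat_eq_append] at *
  rcases lt_trichotomy j.1 k.1 with h | h | h
  · exact main j k l l' h hl hl'
  · obtain rfl : j = k := Fin.ext h
    obtain ⟨h1, h2⟩ := hl.of_append_singleton
    obtain ⟨h3, -⟩ := hl'.of_append_singleton
    rw [hP, hP, step w _ _ j le_rfl h2 h1 h3]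
  · exact (main k j l' l h hl' hl).symm

end Permutations

section Pairing

variable {R S : Type*} [CommRing R] [Ring S] [Algebra R S] {n r : ℕ}
  {E : ((Fin n → Fin r) → R) →ₐ[R] S} {G : Fin (n - 1) → S}

lemma prod_map_mul_spectral
    (hGE : ∀ j f, G j * E f = E (fun k => f (k ∘ simple n j)) * G j)
    (l : List (Fin (n - 1))) (f : (Fin n → Fin r) → R) :
    (l.map G).prod * E f =
      E (fun k => f (k ∘ (l.map (simple n)).prod)) * (l.map G).prod := by
  induction l with
  | nil => simp
  | cons j l ih =>
    rw [List.map_cons, List.prod_cons, mul_assoc, ih, ← mul_assoc, hGE, mul_assoc]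
    rfl

/-- In an algebra generated by a split commutative part and a braided family with quadratic
relations, a functional vanishing on the nontrivial reduced words pairs reduced words to zero
unless they are inverse to each other. -/
theorem trace_mul_reducedWords
    (hGE : ∀ j f, G j * E f = E (fun k => f (k ∘ simple n j)) * G j)
    (hquad : ∀ j, ∃ ε, G j * G j = 1 + G j * E ε)
    (hcomm : ∀ j k : Fin (n - 1), j.1 + 2 ≤ k.1 → G j * G k = G k * G j)
    (hbraid : ∀ j k : Fin (n - 1), k.1 = j.1 + 1 → G j * G k * G j = G k * G j * G k)
    (τ : S →ₗ[R] R)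
    (hτ : ∀ f w l, IsReducedWord n w l → w ≠ 1 → τ (E f * (l.map G).prod) = 0)
    {x y : Equiv.Perm (Fin n)} {lx ly : List (Fin (n - 1))} (hx : IsReducedWord n x lx)
    (hy : IsReducedWord n y ly) (f f' : (Fin n → Fin r) → R) :
    τ (E f * (lx.map G).prod * ((ly.map G).prod * E f')) =
      if x * y = 1 then τ (E (f * f')) else 0 := by
  induction ly generalizing x y lx f with
  | nil =>
    obtain rfl : y = 1 := hy.1.symm
    rw [List.map_nil, List.prod_nil, one_mul, mul_assoc, prod_map_mul_spectral hGE, ← mul_assoc,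
      ← map_mul, mul_one]
    split_ifs with h
    · subst h
      rw [hx.eq_nil]
      simp only [List.map_nil, List.prod_nil, mul_one]
      rfl
    · exact hτ _ _ _ hx h
  | cons s ly ih =>
    have hy' := hy.tail
    rw [List.map_cons, List.prod_cons]
    rcases apply_lo_lt_or_gt x s with h | h
    · have := ih (hx.append_singleton h) hy' f
      rw [List.map_append, List.prod_append, List.map_singleton, List.prod_singleton] at this
      rw [show x * simple n s * (simple n s * y) = x * y by
        rw [mul_assoc, ← mul_assoc (simple n s), simple_mul_self, one_mul]] at this
      rw [← this]
      simp only [mul_assoc]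
    · obtain ⟨lx', h1, h2⟩ := IsReducedWord.exists_append_singleton h
      obtain ⟨ε, hε⟩ := hquad s
      have e1 : (lx.map G).prod = (lx'.map G).prod * G s := by
        rw [hx.prod_map_eq G hcomm hbraid h2]
        simp
      have e2 : E f * (lx.map G).prod * (G s * (ly.map G).prod * E f') =
          E f * (lx'.map G).prod * ((ly.map G).prod * E f') +
            E (f * fun k => ε (k ∘ x)) * (lx.map G).prod * ((ly.map G).prod * E f') := by
        have e3 : (lx.map G).prod * G s =
            (lx'.map G).prod + E (fun k => ε (k ∘ x)) * (lx.map G).prod := by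
          have := prod_map_mul_spectral hGE lx ε
          rw [hx.1] at this
          rw [← this, e1, mul_assoc, hε, mul_add, mul_one, mul_assoc]
        rw [map_mul, mul_assoc (E f) (E _), mul_assoc (G s), ← mul_assoc _ (G s),
          mul_assoc (E f) _ (G s), e3, mul_add, add_mul]
      rw [e2, map_add, ih h1 hy' f, ih hx hy']
      have hne : x * (simple n s * y) ≠ 1 := by
        intro hxy
        have hl1 : lx.length = lx'.length + 1 := by
          have := (isReducedWord_iff.1 hx).2.trans (isReducedWord_iff.1 h2).2.symm
          simpa using this
        have hinv : x * simple n s = y⁻¹ := by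
          rw [← mul_assoc] at hxy
          exact eq_inv_of_mul_eq_one_left hxy
        have hl2 : lx'.length = ly.length + 1 := by
          rw [hinv] at h1
          have := (isReducedWord_iff.1 h1).2.trans (isReducedWord_iff.1 hy.reverse).2.symm
          simpa using this
        have hl3 : lx.length = ly.length := by
          have hx' : x = (simple n s * y)⁻¹ := eq_inv_of_mul_eq_one_left hxy
          rw [hx'] at hx
          have := (isReducedWord_iff.1 hx).2.trans (isReducedWord_iff.1 hy'.reverse).2.symm
          simpa using this
        omega
      rw [if_neg hne, add_zero, show x * simple n s * (simple n s * y) = x * y by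
        rw [mul_assoc, ← mul_assoc (simple n s), simple_mul_self, one_mul]]

end Pairing

section Lagrange

variable {R : Type*} [CommRing R] {r : ℕ} {u : Fin r → R}

lemma isUnit_sub_of_isUnit_prod
    (hΔ : IsUnit (∏ i : Fin r, ∏ j ∈ Finset.univ.filter (fun j => j < i), (u i - u j)))
    {i j : Fin r} (hij : i ≠ j) : IsUnit (u i - u j) := by
  have key : ∀ {i j : Fin r}, j < i → IsUnit (u i - u j) := fun {i j} h => by
    refine isUnit_of_dvd_unit ?_ hΔ
    exact (Finset.dvd_prod_of_mem (fun j => u i - u j) (by simpa using h)).trans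
      (Finset.dvd_prod_of_mem (fun i => ∏ j ∈ Finset.univ.filter (fun j => j < i), (u i - u j))
        (Finset.mem_univ i))
  rcases lt_or_gt_of_ne hij with h | h
  · rw [← neg_sub]
    exact (key h).neg
  · exact key h

lemma natDegree_bpoly_lt (c : Fin r) : (bpoly R r u c).natDegree < r := by
  have h1 : (bpoly R r u c).natDegree ≤
      ∑ j ∈ Finset.univ.filter (fun j => j ≠ c), 1 :=
    (natDegree_prod_le _ _).trans (Finset.sum_le_sum fun j _ =>
      (natDegree_smul_le _ _).trans (natDegree_X_sub_C_le _))
  have h2 : (Finset.univ.filter (fun j => j ≠ c)).card < r := by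
    conv_rhs => rw [← Fintype.card_fin r]
    exact Finset.card_lt_univ_of_notMem (x := c) (by simp)
  simp at h1 h2
  omega

lemma eval_bpoly (hu : ∀ i j : Fin r, i ≠ j → IsUnit (u i - u j)) (c c' : Fin r) :
    (bpoly R r u c).eval (u c') = if c' = c then 1 else 0 := by
  rw [bpoly, eval_prod]
  split_ifs with h
  · subst h
    refine Finset.prod_eq_one fun j hj => ?_
    have : j ≠ c' := by simpa using hj
    simp [Ring.inverse_mul_cancel _ (hu c' j this.symm)]
  · exact Finset.prod_eq_zero (i := c') (by simpa using h) (by simp)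

lemma sum_bpoly [IsDomain R] (hr : 1 ≤ r) (hu : ∀ i j : Fin r, i ≠ j → IsUnit (u i - u j)) :
    ∑ c, bpoly R r u c = 1 := by
  have hinj : Function.Injective u := fun i j h => by
    by_contra hij
    have := (hu i j hij).ne_zero
    exact this (sub_eq_zero.2 h)
  refine Polynomial.eq_of_degrees_lt_of_eval_index_eq (s := Finset.univ) (v := u)
    hinj.injOn ?_ ?_ ?_
  · rw [Finset.card_univ, Fintype.card_fin]
    refine (degree_sum_le _ _).trans_lt ?_
    rw [Finset.sup_lt_iff (WithBot.bot_lt_coe _)]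
    exact fun c _ => degree_le_natDegree.trans_lt (by exact_mod_cast natDegree_bpoly_lt c)
  · rw [Finset.card_univ, Fintype.card_fin]
    exact degree_one_le.trans_lt (by exact_mod_cast hr)
  · intro i _
    simp [eval_finsetSum, eval_bpoly hu]

lemma X_sub_C_mul_bpoly (c : Fin r) :
    ∃ a : R, (X - C (u c)) * bpoly R r u c = C a * ∏ c : Fin r, (X - C (u c)) := by
  refine ⟨∏ j ∈ Finset.univ.filter (fun j => j ≠ c), Ring.inverse (u c - u j), ?_⟩
  have : ∏ c : Fin r, (X - C (u c)) =
      (X - C (u c)) * ∏ j ∈ Finset.univ.filter (fun j => j ≠ c), (X - C (u j)) := by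
    rw [Finset.filter_ne', Finset.mul_prod_erase _ (fun c => X - C (u c)) (Finset.mem_univ c)]
  rw [this, bpoly, map_prod]
  simp only [smul_eq_C_mul, Finset.prod_mul_distrib]
  ring

open scoped IsMulCommutative in
/-- The idempotents of a split family of pairwise commuting elements assemble to an algebra
homomorphism from the functions on the joint spectrum. -/
theorem exists_spectral [IsDomain R] {S : Type*} [Ring S] [Algebra R S] {n : ℕ} (hr : 1 ≤ r)
    (hu : ∀ i j : Fin r, i ≠ j → IsUnit (u i - u j)) (t : Fin n → S)
    (ht : ∀ i j, t i * t j = t j * t i)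
    (hP : ∀ i, aeval (t i) (∏ c : Fin r, (X - C (u c))) = 0) :
    ∃ E : ((Fin n → Fin r) → R) →ₐ[R] S,
      (∀ k, E (Pi.single k 1) =
        (List.ofFn fun i => aeval (t i) (bpoly R r u (k i))).prod) ∧
      ∀ i, E (fun k => u (k i)) = t i := by
  obtain ⟨φ, hφ⟩ : ∃ φ : MvPolynomial (Fin n) R →ₐ[R] S, ∀ i, φ (MvPolynomial.X i) = t i := by
    have : IsMulCommutative (Algebra.adjoin R (Set.range t)) := Algebra.isMulCommutative_adjoin R (by
      rintro _ ⟨i, rfl⟩ _ ⟨j, rfl⟩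
      exact ht i j)
    refine ⟨(Algebra.adjoin R (Set.range t)).val.comp (MvPolynomial.aeval fun i =>
      ⟨t i, Algebra.subset_adjoin ⟨i, rfl⟩⟩), fun i => ?_⟩
    simp
  let e : (Fin n → Fin r) → MvPolynomial (Fin n) R := fun k =>
    ∏ i, aeval (MvPolynomial.X i) (bpoly R r u (k i))
  have he : ∀ k, φ (e k) = (List.ofFn fun i => aeval (t i) (bpoly R r u (k i))).prod := by
    intro k
    rw [show e k = (List.ofFn fun i => aeval (MvPolynomial.X i) (bpoly R r u (k i))).prod from
      List.prod_ofFn.symm, map_list_prod, List.map_ofFn]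
    congr 2
    funext i
    simp only [Function.comp, ← hφ, aeval_algHom_apply]
  have hsum : ∑ k, φ (e k) = 1 := by
    rw [← map_sum]
    have : ∑ k, e k = 1 := by
      have := Finset.prod_univ_sum (fun _ : Fin n => (Finset.univ : Finset (Fin r)))
        (fun i c => aeval (MvPolynomial.X i : MvPolynomial (Fin n) R) (bpoly R r u c))
      rw [Fintype.piFinset_univ] at this
      rw [← this]
      refine Finset.prod_eq_one fun i _ => ?_
      rw [← map_sum, sum_bpoly hr hu, map_one]
    rw [this, map_one]
  have heig : ∀ i k, t i * φ (e k) = u (k i) • φ (e k) := by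
    intro i k
    obtain ⟨a, ha⟩ := X_sub_C_mul_bpoly (u := u) (k i)
    have h1 : (MvPolynomial.X i - MvPolynomial.C (u (k i))) * e k =
        aeval (MvPolynomial.X i) (C a * ∏ c : Fin r, (X - C (u c))) *
          ∏ j ∈ Finset.univ.erase i, aeval (MvPolynomial.X j) (bpoly R r u (k j)) := by
      rw [← ha, map_mul, map_sub, aeval_X, aeval_C, mul_assoc,
        Finset.mul_prod_erase _ (fun j => aeval (MvPolynomial.X j) (bpoly R r u (k j)))
          (Finset.mem_univ i)]
      rfl
    have h2 := congrArg φ h1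
    rw [map_mul, map_mul, ← aeval_algHom_apply, hφ, map_mul, hP, mul_zero, zero_mul, map_sub, hφ,
      sub_mul, sub_eq_zero] at h2
    rw [h2, Algebra.smul_def]
    congr 1
    exact φ.commutes _
  have heval : ∀ p k, φ p * φ (e k) = MvPolynomial.eval (u ∘ k) p • φ (e k) := by
    intro p k
    induction p using MvPolynomial.induction_on with
    | C a =>
      rw [MvPolynomial.eval_C, Algebra.smul_def]
      congr 1
      exact φ.commutes _
    | add p q hp hq => rw [map_add, map_add, add_mul, hp, hq, add_smul]
    | mul_X p i hp =>
      rw [map_mul, map_mul, mul_assoc, hφ, heig, mul_smul_comm, hp, smul_smul,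
        MvPolynomial.eval_X, mul_comm]
      rfl
  have hmul : ∀ k k', φ (e k) * φ (e k') = if k = k' then φ (e k') else 0 := by
    intro k k'
    rw [heval]
    have h1 : MvPolynomial.eval (u ∘ k') (e k) =
        ∏ i, (bpoly R r u (k i)).eval (u (k' i)) := by
      rw [map_prod]
      refine Finset.prod_congr rfl fun i _ => ?_
      have := aeval_algHom_apply (MvPolynomial.aeval (u ∘ k') : MvPolynomial (Fin n) R →ₐ[R] R)
        (MvPolynomial.X i) (bpoly R r u (k i))
      simpa using this.symm
    rw [h1]
    simp only [eval_bpoly hu]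
    split_ifs with h
    · subst h
      simp
    · obtain ⟨i, hi⟩ := Function.ne_iff.1 h
      rw [Finset.prod_eq_zero (Finset.mem_univ i) (if_neg (Ne.symm hi)), zero_smul]
  let L : ((Fin n → Fin r) → R) →ₗ[R] S := Fintype.linearCombination R fun k => φ (e k)
  have hL : ∀ f, L f = ∑ k, f k • φ (e k) := fun f => Fintype.linearCombination_apply _ _ _
  refine ⟨AlgHom.ofLinearMap L ?_ ?_, fun k => ?_, fun i => ?_⟩
  · simp [hL, hsum]
  · intro f f'
    rw [hL, hL, hL, Finset.sum_mul_sum]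
    simp [hmul, smul_smul, Finset.sum_ite_eq, mul_comm]
  · rw [AlgHom.ofLinearMap_apply, ← he, Fintype.linearCombination_apply_single, one_smul]
  · rw [AlgHom.ofLinearMap_apply, hL]
    simp only [← heig]
    rw [← Finset.mul_sum, hsum, mul_one]

lemma single_eq_prod_eval_bpoly {n : ℕ} (hu : ∀ i j : Fin r, i ≠ j → IsUnit (u i - u j))
    (k : Fin n → Fin r) :
    (Pi.single k 1 : (Fin n → Fin r) → R) =
      fun k' => ∏ i, (bpoly R r u (k i)).eval (u (k' i)) := by
  funext k'
  simp only [eval_bpoly hu, Pi.single_apply]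
  split_ifs with h
  · subst h
    simp
  · obtain ⟨i, hi⟩ := Function.ne_iff.1 h
    rw [Finset.prod_eq_zero (Finset.mem_univ i) (if_neg hi)]

lemma prod_eval_eq_sum {n : ℕ} (p : Fin n → R[X]) (hp : ∀ i, (p i).natDegree < r) :
    (fun k : Fin n → Fin r => ∏ i, (p i).eval (u (k i))) =
      ∑ c ∈ Fintype.piFinset fun _ : Fin n => Finset.range r,
        (∏ i, (p i).coeff (c i)) • fun k : Fin n → Fin r => ∏ i, u (k i) ^ c i := by
  funext k
  simp only [fun i => eval_eq_sum_range' (hp i) (u (k i)), Finset.prod_univ_sum,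
    Finset.prod_mul_distrib, Finset.sum_apply, Pi.smul_apply, smul_eq_mul]

lemma sum_esym_mul_pow_eq_zero (i : Fin r) :
    ∑ j ∈ Finset.range (r + 1), (-1) ^ j * esym R r u j * u i ^ (r - j) = 0 := by
  have h := congrArg (eval (u i)) (Multiset.prod_X_sub_X_eq_sum_esymm (Finset.univ.val.map u))
  simp only [Multiset.map_map, Multiset.card_map, Finset.card_val, Finset.card_univ,
    Fintype.card_fin, Finset.esymm_map_val, eval_finsetSum, eval_mul, eval_pow, eval_neg,
    eval_one, eval_C, eval_X] at h
  have h0 : eval (u i) (Multiset.map ((fun x => X - C x) ∘ u) Finset.univ.val).prod = 0 := by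
    change eval (u i) (∏ c, (X - C (u c))) = 0
    rw [eval_prod]
    exact Finset.prod_eq_zero (Finset.mem_univ i) (by simp)
  rw [h0] at h
  rw [h]
  exact Finset.sum_congr rfl fun j _ => mul_assoc _ _ _

end Lagrange

section DualPolynomials

variable {R : Type*} [CommRing R] {r : ℕ} {u : Fin r → R}

lemma adjoin_coordinates_eq_top (hu : ∀ i j : Fin r, i ≠ j → IsUnit (u i - u j)) (n : ℕ) :
    Algebra.adjoin R (Set.range fun (i : Fin n) (k : Fin n → Fin r) => u (k i)) = ⊤ := by
  refine eq_top_iff.2 fun f _ => ?_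
  rw [pi_eq_sum_univ' f]
  refine Subalgebra.sum_mem _ fun k _ => Subalgebra.smul_mem _ ?_ _
  have h : (Pi.single k 1 : (Fin n → Fin r) → R) =
      ∏ i, aeval (fun k' : Fin n → Fin r => u (k' i)) (bpoly R r u (k i)) := by
    rw [single_eq_prod_eval_bpoly hu]
    funext k'
    simp only [Finset.prod_apply]
    refine Finset.prod_congr rfl fun i _ => ?_
    simp
  rw [h]
  refine Subalgebra.prod_mem _ fun i _ => ?_
  refine Algebra.adjoin_mono (Set.singleton_subset_iff.2 ?_) (aeval_mem_adjoin_singleton R _)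
  exact ⟨i, rfl⟩

/-- The value at a point of the spectrum of the element dual to the `d`-th power. -/
noncomputable def dualValue (u : Fin r → R) (d : ℕ) (i : Fin r) : R :=
  if d = 0 then 1 else (-1) ^ (r + 1) * Ring.inverse (∏ i, u i) *
    ∑ j ∈ Finset.range (r - d), (-1) ^ j * esym R r u j * u i ^ (r - d - j)

lemma exists_reduction (hu : ∀ i, IsUnit (u i)) {c d : ℕ} (hc : c < r) (hd : d < r) :
    ∃ p : R[X], p.natDegree < r ∧ p.coeff 0 = (if c = d then 1 else 0) ∧
      ∀ i, p.eval (u i) = u i ^ c * dualValue u d i := by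
  rcases Nat.eq_zero_or_pos d with rfl | hd0
  · refine ⟨X ^ c, (natDegree_X_pow_le c).trans_lt hc, ?_, fun i => by simp [dualValue]⟩
    rw [coeff_X_pow]
    simp only [eq_comm]
  simp only [dualValue, if_neg hd0.ne']
  set a : R := (-1) ^ (r + 1) * Ring.inverse (∏ i, u i) with ha
  rcases lt_or_ge c d with h | h
  · refine ⟨C a * ∑ j ∈ Finset.range (r - d),
      C ((-1) ^ j * esym R r u j) * X ^ (c + (r - d - j)), ?_, ?_, fun i => ?_⟩
    · refine (natDegree_C_mul_le _ _).trans_lt ?_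
      refine lt_of_le_of_lt (natDegree_sum_le_of_forall_le (n := r - 1) _ _ fun j hj => ?_)
        (by omega)
      exact (natDegree_C_mul_X_pow_le _ _).trans (by omega)
    · rw [if_neg h.ne, coeff_C_mul, finsetSum_coeff, Finset.sum_eq_zero, mul_zero]
      intro j hj
      rw [Finset.mem_range] at hj
      rw [coeff_C_mul_X_pow, if_neg (by omega)]
    · simp only [eval_mul, eval_C, eval_finsetSum, eval_pow, eval_X, Finset.mul_sum]
      exact Finset.sum_congr rfl fun j _ => by ring
  · refine ⟨C (-a) * ∑ j ∈ Finset.range (d + 1),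
      C ((-1) ^ (r - d + j) * esym R r u (r - d + j)) * X ^ (c - j), ?_, ?_, fun i => ?_⟩
    · refine (natDegree_C_mul_le _ _).trans_lt ?_
      refine lt_of_le_of_lt (natDegree_sum_le_of_forall_le (n := r - 1) _ _ fun j hj => ?_)
        (by omega)
      exact (natDegree_C_mul_X_pow_le _ _).trans (by omega)
    · rw [coeff_C_mul, finsetSum_coeff, Finset.sum_range_succ, Finset.sum_eq_zero, zero_add,
        coeff_C_mul_X_pow]
      · split_ifs with h1 h2 h2
        · have hσ : esym R r u r = ∏ i, u i := by
            rw [esym]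
            have := Finset.powersetCard_self (Finset.univ : Finset (Fin r))
            rw [Finset.card_fin] at this
            rw [this, Finset.sum_singleton]
          have hinv : Ring.inverse (∏ i, u i) * ∏ i, u i = 1 :=
            Ring.inverse_mul_cancel _ (IsUnit.prod_univ_iff.2 hu)
          rw [Nat.sub_add_cancel hd.le, hσ, ha]
          have hsq : ((-1 : R) ^ r) * (-1) ^ r = 1 := by
            rw [← mul_pow]
            simp
          linear_combination (exp := 1) ((-1 : R) ^ r * (-1) ^ r) * hinv + hsq
        · omega
        · omega
        · rw [mul_zero]
      · intro j hj
        rw [Finset.mem_range] at hj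
        rw [coeff_C_mul_X_pow, if_neg (by omega)]
    · have hV := sum_esym_mul_pow_eq_zero (u := u) i
      rw [show r + 1 = (r - d) + (d + 1) by omega, Finset.sum_range_add] at hV
      simp only [eval_mul, eval_C, eval_finsetSum, eval_pow, eval_X]
      have e1 : ∑ j ∈ Finset.range (r - d), (-1) ^ j * esym R r u j * u i ^ (r - j) =
          u i ^ d * ∑ j ∈ Finset.range (r - d),
            (-1) ^ j * esym R r u j * u i ^ (r - d - j) := by
        rw [Finset.mul_sum]
        refine Finset.sum_congr rfl fun j hj => ?_
        rw [Finset.mem_range] at hj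
        rw [show r - j = d + (r - d - j) by omega, pow_add]
        ring
      have e2 : ∑ j ∈ Finset.range (d + 1),
            (-1) ^ (r - d + j) * esym R r u (r - d + j) * u i ^ (c - j) =
          u i ^ (c - d) * ∑ j ∈ Finset.range (d + 1),
            (-1) ^ (r - d + j) * esym R r u (r - d + j) * u i ^ (r - (r - d + j)) := by
        rw [Finset.mul_sum]
        refine Finset.sum_congr rfl fun j hj => ?_
        rw [Finset.mem_range] at hj
        rw [show c - j = (c - d) + (r - (r - d + j)) by omega, pow_add]
        ring
      rw [e1] at hV
      rw [e2, show u i ^ c = u i ^ (c - d) * u i ^ d by rw [← pow_add]; congr 1; omega]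
      linear_combination (-a * u i ^ (c - d)) * hV

end DualPolynomials

lemma braid_of_braid_add {S : Type*} [Ring S] {a b x12 x13 x23 x21 x32 e12 e23 : S}
    (ha12 : a * x12 = x21 * a) (ha23 : a * x23 = x13 * a) (ha13 : a * x13 = x23 * a)
    (hb12 : b * x12 = x13 * b) (hb13 : b * x13 = x12 * b) (hb23 : b * x23 = x32 * b)
    (ha : a * a = 1 + e12 * a) (hb : b * b = 1 + e23 * b)
    (h1 : x13 * e12 + x12 * x23 + x13 * x21 = x23 * x13)
    (h2 : x13 * e23 + x23 * x12 + x13 * x32 = x12 * x13)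
    (h3 : x12 * x23 * x12 = x23 * x12 * x23)
    (h : (a + x12) * (b + x23) * (a + x12) = (b + x23) * (a + x12) * (b + x23)) :
    a * b * a = b * a * b := by
  have l1 : a * x23 * a = x13 + x13 * e12 * a := by
    rw [ha23, mul_assoc, ha, mul_add, mul_one, mul_assoc]
  have l2 : a * b * x12 = x23 * (a * b) := by
    rw [mul_assoc, hb12, ← mul_assoc, ha13, mul_assoc]
  have l3 : x12 * b * x12 = x12 * x13 * b := by rw [mul_assoc, hb12, mul_assoc]
  have l4 : a * x23 * x12 = x13 * x21 * a := by rw [ha23, mul_assoc, ha12, mul_assoc]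
  have r1 : b * x12 * b = x13 + x13 * e23 * b := by
    rw [hb12, mul_assoc, hb, mul_add, mul_one, mul_assoc]
  have r2 : b * a * x23 = x12 * (b * a) := by
    rw [mul_assoc, ha23, ← mul_assoc, hb13, mul_assoc]
  have r3 : x23 * a * x23 = x23 * x13 * a := by rw [mul_assoc, ha23, mul_assoc]
  have r4 : b * x12 * x23 = x13 * x32 * b := by rw [hb12, mul_assoc, hb23, mul_assoc]
  have hl : (a + x12) * (b + x23) * (a + x12) = a * b * a + (x12 * (b * a) + x23 * (a * b) + x13 +
      x23 * x13 * a + x12 * x13 * b + x12 * x23 * x12) := by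
    rw [← h1]
    simp only [add_mul, mul_add]
    rw [l1, l2, l3, l4, mul_assoc x12 b a]
    abel
  have hr : (b + x23) * (a + x12) * (b + x23) = b * a * b + (x12 * (b * a) + x23 * (a * b) + x13 +
      x23 * x13 * a + x12 * x13 * b + x12 * x23 * x12) := by
    rw [h3, ← h2]
    simp only [add_mul, mul_add]
    rw [r1, r2, r3, r4, mul_assoc x23 a b]
    abel
  rw [hl, hr] at h
  exact add_right_cancel h

section Spectral

variable {R : Type*} [CommRing R] {n r : ℕ} {q Δ : Rˣ} {u : Fin r → R} {F : Fin r → R[X]}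

lemma pim_eq_of_rel {x y : FA R n} (h : Rel R n r q Δ u F x y) :
    pim R n r q Δ u F x = pim R n r q Δ u F y := RingQuot.mkAlgHom_rel R h

lemma pim_aeval_tf (i : Fin n) (p : R[X]) :
    pim R n r q Δ u F (aeval (tf R n i) p) = aeval (tt R n r q Δ u F i) p :=
  (aeval_algHom_apply _ _ _).symm

lemma tt_comm (i j : Fin n) :
    tt R n r q Δ u F i * tt R n r q Δ u F j = tt R n r q Δ u F j * tt R n r q Δ u F i := by
  simpa only [tt, map_mul] using pim_eq_of_rel (.tcomm i j)

lemma aeval_tt_prod_X_sub_C (i : Fin n) :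
    aeval (tt R n r q Δ u F i) (∏ c : Fin r, (X - C (u c))) = 0 := by
  rw [← pim_aeval_tf, pim_eq_of_rel (.tord i), map_zero]

variable (q) in
/-- The function `(q - q⁻¹) 1_{k_i < k_j}`. -/
noncomputable def ltFun (i j : Fin n) (k : Fin n → Fin r) : R :=
  if k i < k j then (q : R) - ((q⁻¹ : Rˣ) : R) else 0

variable (q) in
/-- The function `(q - q⁻¹) 1_{k_i = k_j}`. -/
noncomputable def eqFun (i j : Fin n) (k : Fin n → Fin r) : R :=
  if k i = k j then (q : R) - ((q⁻¹ : Rˣ) : R) else 0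

variable (q Δ F) in
/-- `E` is the homomorphism from functions on the joint spectrum of the `t_i` sending indicator
functions to the idempotents `b_k` and coordinates to the `t_i`. -/
structure IsSpectral (E : ((Fin n → Fin r) → R) →ₐ[R] Hnr R n r q Δ u F) : Prop where
  single : ∀ k, E (Pi.single k 1) = b R n r q Δ u F k
  coord : ∀ i, E (fun k => u (k i)) = tt R n r q Δ u F i

variable {E : ((Fin n → Fin r) → R) →ₐ[R] Hnr R n r q Δ u F}

lemma IsSpectral.aeval_tt (hE : IsSpectral q Δ F E) (i : Fin n) (p : R[X]) :
    aeval (tt R n r q Δ u F i) p = E (fun k => p.eval (u (k i))) := by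
  rw [← hE.coord, aeval_algHom_apply]
  congr 1
  funext k
  simp

lemma IsSpectral.B'_eq (hE : IsSpectral q Δ F E) (i j : Fin n) :
    B' R n r q Δ u F i j = -E (ltFun q i j) := by
  rw [B']
  simp only [← hE.single]
  rw [← map_sum, ← map_smul]
  congr 2
  funext k
  simp [ltFun, Finset.sum_apply, Pi.single_apply, Finset.sum_ite_eq]

lemma IsSpectral.TT_eq (hE : IsSpectral q Δ F E) (j : Fin (n - 1)) :
    TT R n r q Δ u F j = g R n r q Δ u F j + E (ltFun q (lo n j) (hi n j)) := by
  rw [g, hE.B'_eq, neg_add_cancel_right]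

lemma IsSpectral.pim_Bel (hE : IsSpectral q Δ F E)
    (hF : ∀ c c' : Fin r, (F c).eval (u c') = if c' = c then (Δ : R) else 0) (j : Fin (n - 1)) :
    pim R n r q Δ u F (Bel R n r q Δ u F j) =
      E (fun k => ltFun q (lo n j) (hi n j) k * (u (k (hi n j)) - u (k (lo n j)))) := by
  simp only [Bel, map_sum, map_smul, map_mul, pim_aeval_tf, hE.aeval_tt]
  simp only [← map_mul, ← map_smul, ← map_sum]
  congr 1
  funext k
  simp only [Finset.sum_filter]
  simp only [hF]
  rw [Finset.sum_apply]
  simp_rw [Finset.sum_apply, ite_apply, Pi.smul_apply, Pi.mul_apply, Pi.zero_apply, smul_eq_mul]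
  rw [Finset.sum_eq_single (k (hi n j)), Finset.sum_eq_single (k (lo n j))]
  · rw [ltFun]
    split_ifs
    · have : ((Δ⁻¹ : Rˣ) : R) * (Δ : R) = 1 := Δ.inv_mul
      linear_combination (u (k (hi n j)) - u (k (lo n j))) * ((q : R) - ((q⁻¹ : Rˣ) : R)) *
        (((Δ⁻¹ : Rˣ) : R) * (Δ : R) + 1) * this
    all_goals simp_all
  · intro c _ hc
    simp [hc.symm]
  · simp
  · intro c _ hc
    refine Finset.sum_eq_zero fun c' _ => ?_
    simp [hc.symm]
  · simp

lemma IsSpectral.g_mul_tt (hE : IsSpectral q Δ F E)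
    (hF : ∀ c c' : Fin r, (F c).eval (u c') = if c' = c then (Δ : R) else 0)
    (j : Fin (n - 1)) (i : Fin n) :
    g R n r q Δ u F j * tt R n r q Δ u F i =
      tt R n r q Δ u F (simple n j i) * g R n r q Δ u F j := by
  have hg : g R n r q Δ u F j = TT R n r q Δ u F j - E (ltFun q (lo n j) (hi n j)) := by
    rw [hE.TT_eq, add_sub_cancel_right]
  by_cases h1 : i = lo n j
  · subst h1
    have h := pim_eq_of_rel (q := q) (Δ := Δ) (u := u) (F := F) (.Tlo j)
    rw [map_sub, hE.pim_Bel hF, map_mul, map_mul] at h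
    change TT R n r q Δ u F j * tt R n r q Δ u F (lo n j) =
      tt R n r q Δ u F (hi n j) * TT R n r q Δ u F j - _ at h
    rw [simple_lo, hg, sub_mul, mul_sub, h, ← hE.coord, ← hE.coord, ← map_mul, ← map_mul, sub_sub,
      ← map_add]
    congr 2
    funext k
    simp only [Pi.add_apply, Pi.mul_apply]
    ring
  by_cases h2 : i = hi n j
  · subst h2
    have h := pim_eq_of_rel (q := q) (Δ := Δ) (u := u) (F := F) (.Thi j)
    rw [map_add, hE.pim_Bel hF, map_mul, map_mul] at h
    change TT R n r q Δ u F j * tt R n r q Δ u F (hi n j) =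
      tt R n r q Δ u F (lo n j) * TT R n r q Δ u F j + _ at h
    rw [simple_hi, hg, sub_mul, mul_sub, h, ← hE.coord, ← hE.coord, ← map_mul, ← map_mul,
      add_sub_assoc, ← map_sub, sub_eq_add_neg (_ * TT R n r q Δ u F j), ← map_neg]
    congr 2
    funext k
    simp only [Pi.sub_apply, Pi.neg_apply, Pi.mul_apply]
    ring
  · have h := pim_eq_of_rel (q := q) (Δ := Δ) (u := u) (F := F) (.Tt j i h1 h2)
    rw [map_mul, map_mul] at h
    change TT R n r q Δ u F j * tt R n r q Δ u F i = tt R n r q Δ u F i * TT R n r q Δ u F j at h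
    rw [simple_of_ne j h1 h2, hg, sub_mul, mul_sub, h, ← hE.coord, ← map_mul, ← map_mul,
      mul_comm (ltFun q _ _)]

lemma IsSpectral.g_mul (hE : IsSpectral q Δ F E)
    (hu : ∀ i j : Fin r, i ≠ j → IsUnit (u i - u j))
    (hF : ∀ c c' : Fin r, (F c).eval (u c') = if c' = c then (Δ : R) else 0)
    (j : Fin (n - 1)) (f : (Fin n → Fin r) → R) :
    g R n r q Δ u F j * E f = E (fun k => f (k ∘ simple n j)) * g R n r q Δ u F j := by
  have hf : f ∈ Algebra.adjoin R
      (Set.range fun (i : Fin n) (k : Fin n → Fin r) => u (k i)) := by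
    rw [adjoin_coordinates_eq_top hu]
    trivial
  induction hf using Algebra.adjoin_induction with
  | mem f hf =>
    obtain ⟨i, rfl⟩ := hf
    rw [hE.coord, hE.g_mul_tt hF, ← hE.coord]
    rfl
  | algebraMap a =>
    have : (fun k => algebraMap R ((Fin n → Fin r) → R) a (k ∘ simple n j)) =
        algebraMap R ((Fin n → Fin r) → R) a := rfl
    rw [this, AlgHom.commutes, Algebra.commutes]
  | add f f' _ _ h h' =>
    rw [map_add, mul_add, h, h', ← add_mul, ← map_add]
    rfl
  | mul f f' _ _ h h' =>
    rw [map_mul, ← mul_assoc, h, mul_assoc, h', ← mul_assoc, ← map_mul]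
    rfl

lemma ltFun_comp (σ : Equiv.Perm (Fin n)) (i j : Fin n) :
    (fun k : Fin n → Fin r => ltFun q i j (k ∘ σ)) = ltFun q (σ i) (σ j) := rfl

lemma IsSpectral.g_mul_self (hE : IsSpectral q Δ F E)
    (hu : ∀ i j : Fin r, i ≠ j → IsUnit (u i - u j))
    (hF : ∀ c c' : Fin r, (F c).eval (u c') = if c' = c then (Δ : R) else 0)
    (j : Fin (n - 1)) :
    g R n r q Δ u F j * g R n r q Δ u F j =
      1 + E (eqFun q (lo n j) (hi n j)) * g R n r q Δ u F j := by
  set G := g R n r q Δ u F j with hG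
  set x : (Fin n → Fin r) → R := ltFun q (lo n j) (hi n j) with hx
  set h : R := (q : R) - ((q⁻¹ : Rˣ) : R) with hh
  have hT : TT R n r q Δ u F j * TT R n r q Δ u F j = 1 + h • TT R n r q Δ u F j := by
    have := pim_eq_of_rel (q := q) (Δ := Δ) (u := u) (F := F) (.quad j)
    rw [map_mul, map_sub, map_add, map_zero, AlgHom.commutes, AlgHom.commutes] at this
    change (TT R n r q Δ u F j - _) * (TT R n r q Δ u F j + _) = 0 at this
    rw [sub_mul, mul_add, mul_add, ← map_mul, Units.mul_inv, map_one, ← Algebra.commutes,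
      ← Algebra.smul_def, ← Algebra.smul_def] at this
    have hsub : h • TT R n r q Δ u F j =
        (q : R) • TT R n r q Δ u F j - ((q⁻¹ : Rˣ) : R) • TT R n r q Δ u F j := by
      simp only [Algebra.smul_def, hh, map_sub, sub_mul]
    rw [hsub, ← sub_eq_zero, ← this]
    abel
  have hswap : G * E x = E (ltFun q (hi n j) (lo n j)) * G := by
    rw [hE.g_mul hu hF, hx, ltFun_comp, simple_lo, simple_hi]
  have hxx : E x * E x = h • E x := by
    rw [← map_mul, ← map_smul]
    congr 1
    funext k
    simp only [hx, ltFun, Pi.mul_apply, Pi.smul_apply, smul_eq_mul, ← hh]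
    split_ifs <;> simp
  have hsum : E (eqFun q (lo n j) (hi n j)) =
      algebraMap R _ h - E (ltFun q (hi n j) (lo n j)) - E x := by
    rw [← E.commutes, ← map_sub, ← map_sub]
    congr 1
    funext k
    simp only [hx, ltFun, eqFun, Pi.sub_apply, Pi.algebraMap_apply, Algebra.algebraMap_self,
      RingHom.id_apply, ← hh]
    rcases lt_trichotomy (k (lo n j)) (k (hi n j)) with h1 | h1 | h1
    · simp [h1, h1.ne, h1.not_gt]
    · simp [h1]
    · simp [h1, h1.ne', h1.not_gt]
  rw [hE.TT_eq, ← hG, ← hx, add_mul, mul_add, mul_add, hswap, hxx, smul_add] at hT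
  rw [hsum, sub_mul, sub_mul, ← Algebra.smul_def]
  have := sub_eq_zero.2 hT
  rw [← sub_eq_zero, ← this]
  abel

lemma IsSpectral.g_comm (hE : IsSpectral q Δ F E)
    (hu : ∀ i j : Fin r, i ≠ j → IsUnit (u i - u j))
    (hF : ∀ c c' : Fin r, (F c).eval (u c') = if c' = c then (Δ : R) else 0)
    {j k : Fin (n - 1)} (hjk : j.1 + 2 ≤ k.1) :
    g R n r q Δ u F j * g R n r q Δ u F k = g R n r q Δ u F k * g R n r q Δ u F j := by
  have hT := pim_eq_of_rel (q := q) (Δ := Δ) (u := u) (F := F) (.Tcomm j k (.inl hjk))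
  rw [map_mul, map_mul] at hT
  change TT R n r q Δ u F j * TT R n r q Δ u F k = TT R n r q Δ u F k * TT R n r q Δ u F j at hT
  have h1 : g R n r q Δ u F j * E (ltFun q (lo n k) (hi n k)) =
      E (ltFun q (lo n k) (hi n k)) * g R n r q Δ u F j := by
    rw [hE.g_mul hu hF, ltFun_comp, simple_of_ne, simple_of_ne] <;>
      simp [lo, hi, Fin.ext_iff] <;> omega
  have h2 : g R n r q Δ u F k * E (ltFun q (lo n j) (hi n j)) =
      E (ltFun q (lo n j) (hi n j)) * g R n r q Δ u F k := by
    rw [hE.g_mul hu hF, ltFun_comp, simple_of_ne, simple_of_ne] <;>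
      simp [lo, hi, Fin.ext_iff] <;> omega
  have h3 : E (ltFun q (lo n j) (hi n j)) * E (ltFun q (lo n k) (hi n k)) =
      E (ltFun q (lo n k) (hi n k)) * E (ltFun q (lo n j) (hi n j)) := by
    rw [← map_mul, mul_comm, map_mul]
  rw [hE.TT_eq, hE.TT_eq, add_mul, mul_add, mul_add, add_mul, mul_add, mul_add, h1, h2, h3] at hT
  rw [← sub_eq_zero] at hT ⊢
  rw [← hT]
  abel

lemma IsSpectral.g_braid (hE : IsSpectral q Δ F E)
    (hu : ∀ i j : Fin r, i ≠ j → IsUnit (u i - u j))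
    (hF : ∀ c c' : Fin r, (F c).eval (u c') = if c' = c then (Δ : R) else 0)
    {j k : Fin (n - 1)} (hjk : k.1 = j.1 + 1) :
    g R n r q Δ u F j * g R n r q Δ u F k * g R n r q Δ u F j =
      g R n r q Δ u F k * g R n r q Δ u F j * g R n r q Δ u F k := by
  have hT := pim_eq_of_rel (q := q) (Δ := Δ) (u := u) (F := F) (.braid j k hjk)
  simp only [map_mul] at hT
  change TT R n r q Δ u F j * TT R n r q Δ u F k * TT R n r q Δ u F j =
    TT R n r q Δ u F k * TT R n r q Δ u F j * TT R n r q Δ u F k at hT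
  have e1 : lo n k = hi n j := by simp [lo, hi, hjk]
  have f1 : simple n j (hi n k) = hi n k :=
    simple_of_ne _ (by simp [lo, hi, Fin.ext_iff]; omega) (by simp [hi, Fin.ext_iff]; omega)
  have f2 : simple n k (lo n j) = lo n j :=
    simple_of_ne _ (by simp [lo, Fin.ext_iff]; omega) (by simp [lo, hi, Fin.ext_iff]; omega)
  have f3 : simple n k (hi n j) = hi n k := by rw [← e1, simple_lo]
  have f4 : simple n k (hi n k) = hi n j := by rw [simple_hi, e1]
  have hk := hE.g_mul_self hu hF k
  rw [hE.TT_eq, hE.TT_eq, e1] at hT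
  rw [e1] at hk
  refine braid_of_braid_add (x13 := E (ltFun q (lo n j) (hi n k)))
    (x21 := E (ltFun q (hi n j) (lo n j))) (x32 := E (ltFun q (hi n k) (hi n j)))
    ?_ ?_ ?_ ?_ ?_ ?_ (hE.g_mul_self hu hF j) hk ?_ ?_ ?_ hT
  iterate 6
    rw [hE.g_mul hu hF, ltFun_comp]
    simp only [f1, f2, f3, f4, simple_lo, simple_hi]
  all_goals
    simp only [← map_mul, ← map_add]
    congr 1
    funext x
    simp only [ltFun, eqFun, Pi.mul_apply, Pi.add_apply]
    generalize x (lo n j) = α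
    generalize x (hi n j) = β
    generalize x (hi n k) = γ
    split_ifs <;> first | (exfalso; omega) | ring

lemma IsSpectral.tmon_eq (hE : IsSpectral q Δ F E) (c : Fin n → ℕ) :
    tmon R n r q Δ u F c = E (fun k => ∏ i, u (k i) ^ c i) := by
  have h : (fun k : Fin n → Fin r => ∏ i, u (k i) ^ c i) =
      (List.ofFn fun i => (fun k : Fin n → Fin r => u (k i)) ^ c i).prod := by
    rw [List.prod_ofFn]
    funext k
    simp [Finset.prod_apply]
  rw [h, map_list_prod, List.map_ofFn, tmon]
  congr 2
  funext i
  rw [Function.comp_apply, map_pow, hE.coord]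

lemma IsSpectral.tdualprod_eq (hE : IsSpectral q Δ F E) (d : Fin n → ℕ) :
    tdualprod R n r q Δ u F d = E (fun k => ∏ i, dualValue u (d i) (k i)) := by
  have h : (fun k : Fin n → Fin r => ∏ i, dualValue u (d i) (k i)) =
      (List.ofFn fun i => (fun k : Fin n → Fin r => dualValue u (d i) (k i))).prod := by
    rw [List.prod_ofFn]
    funext k
    simp [Finset.prod_apply]
  rw [h, map_list_prod, List.map_ofFn, tdualprod]
  congr 2
  funext i
  rw [Function.comp_apply]
  by_cases hd : d i = 0
  · simp only [hd, dualValue, if_true]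
    exact (map_one E).symm
  · simp only [dualValue, if_neg hd, tdual]
    simp only [← hE.coord, ← map_pow, ← map_smul, ← map_sum]
    congr 1
    funext k
    simp [Finset.sum_apply, smul_eq_mul]

end Spectral

end MAK

/-- Proposition 4.5: the family `(t_1^{c_1}⋯t_n^{c_n} g_w)^∨ = g_{w⁻¹} ∏_{i : c_i ≠ 0} (t_i^{c_i})^∨`
is dual to the basis `t_1^{c_1}⋯t_n^{c_n} g_w` with respect to `(x,y) ↦ τ(xy)`. -/
theorem statement16
    (R : Type*) [CommRing R] [IsDomain R] (n r : ℕ) (hn : 1 ≤ n) (hr : 1 ≤ r)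
    (q Δ : Rˣ) (u : Fin r → R) (F : Fin r → R[X])
    (hΔ : (Δ : R) = ∏ i : Fin r, ∏ j ∈ Finset.univ.filter (fun j => j < i), (u i - u j))
    (hFdeg : ∀ c : Fin r, (F c).degree = ((r - 1 : ℕ) : WithBot ℕ))
    (hFeval : ∀ c c' : Fin r, (F c).eval (u c') = if c' = c then (Δ : R) else 0)
    (hu : ∀ i : Fin r, IsUnit (u i))
    (τ : Hnr R n r q Δ u F →ₗ[R] R)
    (hτ : ∀ c : Fin n → ℕ, (∀ i, c i ≤ r - 1) →
      ∀ (w : Equiv.Perm (Fin n)) (l : List (Fin (n - 1))), IsReducedWord n w l →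
        τ (tmon R n r q Δ u F c * gword R n r q Δ u F l) = if w = 1 ∧ c = 0 then 1 else 0)
    (w w' : Equiv.Perm (Fin n)) (c d : Fin n → ℕ)
    (hc : ∀ i, c i ≤ r - 1) (hd : ∀ i, d i ≤ r - 1)
    (lw lw' : List (Fin (n - 1)))
    (hlw : IsReducedWord n w lw) (hlw' : IsReducedWord n w'⁻¹ lw') :
    τ (tmon R n r q Δ u F c * gword R n r q Δ u F lw *
        (gword R n r q Δ u F lw' * tdualprod R n r q Δ u F d)) =
      if w = w' ∧ c = d then 1 else 0 := by
  have hsub : ∀ i j : Fin r, i ≠ j → IsUnit (u i - u j) := fun i j hij =>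
    isUnit_sub_of_isUnit_prod (hΔ ▸ Δ.isUnit) hij
  obtain ⟨E, hE₁, hE₂⟩ := exists_spectral hr hsub (tt R n r q Δ u F) tt_comm
    aeval_tt_prod_X_sub_C
  have hE : IsSpectral q Δ F E := ⟨hE₁, hE₂⟩
  have hτE : ∀ p : Fin n → R[X], (∀ i, (p i).natDegree < r) →
      ∀ (v : Equiv.Perm (Fin n)) (l : List (Fin (n - 1))), IsReducedWord n v l →
        τ (E (fun k => ∏ i, (p i).eval (u (k i))) * (l.map (g R n r q Δ u F)).prod) =
          if v = 1 then ∏ i, (p i).coeff 0 else 0 := by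
    intro p hp v l hl
    rw [prod_eval_eq_sum p hp, map_sum, Finset.sum_mul, map_sum]
    have hterm : ∀ c ∈ Fintype.piFinset (fun _ : Fin n => Finset.range r),
        τ (E ((∏ i, (p i).coeff (c i)) • fun k : Fin n → Fin r => ∏ i, u (k i) ^ c i) *
          (l.map (g R n r q Δ u F)).prod) =
        if c = 0 then if v = 1 then ∏ i, (p i).coeff 0 else 0 else 0 := by
      intro c hc
      rw [Fintype.mem_piFinset] at hc
      have := hτ c (fun i => Nat.le_sub_one_of_lt (Finset.mem_range.1 (hc i))) v l hl
      rw [hE.tmon_eq, gword] at this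
      rw [map_smul, smul_mul_assoc, map_smul, this]
      by_cases h0 : c = 0
      · subst h0
        simp
      · simp [h0]
    rw [Finset.sum_congr rfl hterm, Finset.sum_ite_eq', if_pos]
    exact Fintype.mem_piFinset.2 fun i => Finset.mem_range.2 hr
  have hτ0 : ∀ f v l, IsReducedWord n v l → v ≠ 1 →
      τ (E f * (l.map (g R n r q Δ u F)).prod) = 0 := by
    intro f v l hl hv
    have hf : f = ∑ k, f k • (Pi.single k 1 : (Fin n → Fin r) → R) := by
      funext k
      simp [Finset.sum_apply, Pi.single_apply]
    rw [hf, map_sum, Finset.sum_mul, map_sum]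
    refine Finset.sum_eq_zero fun k _ => ?_
    rw [map_smul, smul_mul_assoc, map_smul, single_eq_prod_eval_bpoly hsub,
      hτE _ (fun i => natDegree_bpoly_lt (k i)) v l hl, if_neg hv, smul_zero]
  have hquad : ∀ j, ∃ ε, g R n r q Δ u F j * g R n r q Δ u F j =
      1 + g R n r q Δ u F j * E ε := fun j => by
    refine ⟨eqFun q (lo n j) (hi n j), ?_⟩
    rw [hE.g_mul_self hsub hFeval, hE.g_mul hsub hFeval]
    congr 3
    funext k
    simp [eqFun, simple_lo, simple_hi, eq_comm]
  rw [hE.tmon_eq, hE.tdualprod_eq, gword, gword,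
    trace_mul_reducedWords (hE.g_mul hsub hFeval) hquad (fun j k h => hE.g_comm hsub hFeval h)
      (fun j k h => hE.g_braid hsub hFeval h) τ hτ0 hlw hlw']
  simp only [mul_inv_eq_one]
  by_cases hw : w = w'
  · choose p hp1 hp2 hp3 using fun i : Fin n =>
      exists_reduction hu (c := c i) (d := d i) (by have := hc i; omega) (by have := hd i; omega)
    have hfun : ((fun k : Fin n → Fin r => ∏ i, u (k i) ^ c i) *
        fun k => ∏ i, dualValue u (d i) (k i)) = fun k => ∏ i, (p i).eval (u (k i)) := by
      funext k
      simp only [Pi.mul_apply, hp3, Finset.prod_mul_distrib]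
    have := hτE p hp1 1 [] isReducedWord_nil
    rw [List.map_nil, List.prod_nil, mul_one, if_pos rfl] at this
    rw [if_pos hw, hfun, this]
    simp only [hp2, hw, true_and, Finset.prod_ite_zero, Finset.prod_const_one, funext_iff]
    simp
  · simp [hw]
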